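/- If a sequence of harmonic (real parts of holomorphic) functions on a connected open subset U of ℂ is locally uniformly bounded and converges pointwise on U to a function L, then L is harmonic on U. -/

import Mathlib

open Metric

/-- A real-valued function is harmonic on `U` if near every point of `U`
it is the real part of a holomorphic function. -/
def IsHarmonicOn (h : ℂ → ℝ) (U : Set ℂ) : Prop :=
  ∀ z ∈ U, ∃ r > 0, ball z r ⊆ U ∧
    ∃ F : ℂ → ℂ, DifferentiableOn ℂ F (ball z r) ∧
      ∀ w ∈ ball z r, h w = (F w).re

open InnerProductSpace Complex in
theorem IsHarmonicOn.harmonicOnNhd_aux {h : ℂ → ℝ} {U : Set ℂ} (hh : IsHarmonicOn h U) :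
    HarmonicOnNhd h U := by
  intro z hz
  obtain ⟨r, hr, _, F, hF, hFe⟩ := hh z hz
  have hb : ball z r ∈ nhds z := ball_mem_nhds z hr
  have : h =ᶠ[nhds z] fun w => (F w).re := Filter.eventually_of_mem hb hFe
  rw [harmonicAt_congr_nhds this]
  exact (hF.analyticAt hb).harmonicAt_re

open Complex Real in
theorem herglotz_aux {L : ℂ → ℝ} {c : ℂ} {R : ℝ} (hR : 0 < R) (hL : CircleIntegrable L c R) :
    ∃ F : ℂ → ℂ, DifferentiableOn ℂ F (ball c R) ∧ ∀ w ∈ ball c R,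
      circleAverage ((re ∘ herglotzRieszKernel c w) • L) c R = (F w).re := by
  have hLc : CircleIntegrable (fun ζ ↦ (L ζ : ℂ)) c R := by
    simp only [CircleIntegrable, intervalIntegrable_iff] at hL ⊢
    exact Complex.ofRealCLM.integrable_comp hL
  refine ⟨fun w => 2 * ((2 * π * I : ℂ)⁻¹ • ∮ z in C(c, R), (z - w)⁻¹ • (L z : ℂ)) -
    circleAverage (fun ζ ↦ (L ζ : ℂ)) c R, ?_, ?_⟩
  · lift R to NNReal using hR.le
    have := (hasFPowerSeriesOn_cauchy_integral hLc (by exact_mod_cast hR)).differentiableOn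
    rw [Metric.eball_coe] at this
    exact (this.const_mul 2).sub_const _
  · intro w hw
    have hsub : ∀ z ∈ sphere c R, z - w ≠ 0 := by
      intro z hz h0
      rw [sub_eq_zero.1 h0] at hz
      exact (mem_ball.1 hw).ne (mem_sphere.1 hz)
    have hsubc : ∀ z ∈ sphere c R, z - c ≠ 0 := by
      intro z hz h0
      rw [sub_eq_zero.1 h0] at hz
      simp at hz
      exact hR.ne hz
    have hcont := continuousOn_herglotzRieszKernel_sphere hw
    have h₂ : CircleIntegrable (fun ζ ↦ herglotzRieszKernel c w ζ • (L ζ : ℂ)) c R :=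
      hLc.continuousOn_smul hcont
    have hi1 : CircleIntegrable (fun z ↦ (z - w)⁻¹ • (L z : ℂ)) c R := by
      refine hLc.continuousOn_smul (g := fun z ↦ (z - w)⁻¹) ?_
      rw [abs_of_pos hR]
      exact ContinuousOn.inv₀ (by fun_prop) hsub
    have hi2 : CircleIntegrable (fun z ↦ (z - c)⁻¹ • (L z : ℂ)) c R := by
      refine hLc.continuousOn_smul (g := fun z ↦ (z - c)⁻¹) ?_
      rw [abs_of_pos hR]
      exact ContinuousOn.inv₀ (by fun_prop) hsubc
    have key : circleAverage (fun ζ ↦ herglotzRieszKernel c w ζ • (L ζ : ℂ)) c R =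
        2 * ((2 * π * I : ℂ)⁻¹ • ∮ z in C(c, R), (z - w)⁻¹ • (L z : ℂ)) -
          circleAverage (fun ζ ↦ (L ζ : ℂ)) c R := by
      rw [circleAverage_eq_circleIntegral hR.ne', circleAverage_eq_circleIntegral hR.ne']
      have e : (∮ z in C(c, R), (z - c)⁻¹ • herglotzRieszKernel c w z • (L z : ℂ)) =
          ∮ z in C(c, R), ((2 : ℂ) • ((z - w)⁻¹ • (L z : ℂ)) - (z - c)⁻¹ • (L z : ℂ)) := by
        apply circleIntegral.integral_congr hR.le
        intro z hz
        have h1 := hsub z hz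
        have h2 := hsubc z hz
        have h3 : z - c - (w - c) ≠ 0 := by simpa using h1
        simp only [herglotzRieszKernel_def, smul_eq_mul]
        rw [show z - c - (w - c) = z - w by ring]
        field_simp
        ring
      have hi3 : CircleIntegrable (fun z ↦ (2 : ℂ) • ((z - w)⁻¹ • (L z : ℂ))) c R :=
        hi1.const_smul (a := (2 : ℂ))
      rw [e, circleIntegral.integral_sub hi3 hi2, circleIntegral.integral_smul]
      simp only [smul_eq_mul]
      ring
    calc circleAverage ((re ∘ herglotzRieszKernel c w) • L) c R
        = circleAverage (Complex.reCLM ∘ fun ζ ↦ herglotzRieszKernel c w ζ • (L ζ : ℂ)) c R := by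
          simp [Function.comp_def, Complex.mul_re, Pi.mul_def]
      _ = (circleAverage (fun ζ ↦ herglotzRieszKernel c w ζ • (L ζ : ℂ)) c R).re :=
          Complex.reCLM.circleAverage_comp_comm h₂
      _ = _ := by rw [key]

open Complex Real MeasureTheory in
theorem harmonic_pointwise_limit
    {U : Set ℂ} (hU : IsOpen U) (hUc : IsConnected U)
    (h : ℕ → ℂ → ℝ) (L : ℂ → ℝ)
    (hharm : ∀ n, IsHarmonicOn (h n) U)
    (hbdd : ∀ K ⊆ U, IsCompact K → ∃ C : ℝ, ∀ n, ∀ z ∈ K, |h n z| ≤ C)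
    (hlim : ∀ z ∈ U, Filter.Tendsto (fun n => h n z) Filter.atTop (nhds (L z))) :
    IsHarmonicOn L U := by
  intro c hc
  obtain ⟨R, hR, hRU⟩ := Metric.nhds_basis_closedBall.mem_iff.1 (hU.mem_nhds hc)
  have hmem : ∀ θ, circleMap c R θ ∈ sphere c R := circleMap_mem_sphere c hR.le
  have hmemU : ∀ θ, circleMap c R θ ∈ U := fun θ => hRU (sphere_subset_closedBall (hmem θ))
  obtain ⟨C, hC⟩ := hbdd _ hRU (isCompact_closedBall c R)
  have hharm' := fun n => (hharm n).harmonicOnNhd_aux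
  have hcont : ∀ n, Continuous fun θ => h n (circleMap c R θ) := fun n =>
    (hharm' n).continuousOn.comp_continuous (by fun_prop) hmemU
  have hmeas : Measurable fun θ => L (circleMap c R θ) :=
    measurable_of_tendsto_metrizable (fun n => (hcont n).measurable)
      (tendsto_pi_nhds.2 fun θ => hlim _ (hmemU θ))
  have hLC : ∀ θ, ‖L (circleMap c R θ)‖ ≤ C := fun θ =>
    le_of_tendsto (hlim _ (hmemU θ)).norm
      (Filter.Eventually.of_forall fun n => hC n _ (sphere_subset_closedBall (hmem θ)))
  have hL : CircleIntegrable L c R := by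
    refine (intervalIntegrable_const (c := C)).mono_fun hmeas.aestronglyMeasurable
      (Filter.Eventually.of_forall fun θ => ?_)
    exact (hLC θ).trans (le_abs_self C)
  obtain ⟨F, hF, hFe⟩ := herglotz_aux hR hL
  refine ⟨R, hR, ball_subset_closedBall.trans hRU, F, hF, fun w hw => ?_⟩
  rw [← hFe w hw]
  refine tendsto_nhds_unique (hlim w (hRU (ball_subset_closedBall hw))) ?_
  have hK : Continuous fun θ => (herglotzRieszKernel c w (circleMap c R θ)).re := by
    refine Complex.continuous_re.comp
      ((continuousOn_herglotzRieszKernel_sphere hw).comp_continuous (by fun_prop) ?_)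
    rw [abs_of_pos hR]
    exact hmem
  have := fun n => InnerProductSpace.HarmonicOnNhd.circleAverage_re_herglotzRieszKernel_smul
    ((hharm' n).mono hRU) hw
  simp_rw [← this]
  simp only [circleAverage_def]
  refine Filter.Tendsto.const_smul ?_ _
  refine intervalIntegral.tendsto_integral_filter_of_dominated_convergence
    (fun θ => |(herglotzRieszKernel c w (circleMap c R θ)).re| * C) ?_ ?_ ?_ ?_
  · exact Filter.Eventually.of_forall fun n => (hK.mul (hcont n)).aestronglyMeasurable
  · refine Filter.Eventually.of_forall fun n => Filter.Eventually.of_forall fun θ _ => ?_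
    simp only [Pi.smul_apply', Function.comp_apply, smul_eq_mul, norm_mul, Real.norm_eq_abs]
    exact mul_le_mul_of_nonneg_left (hC n _ (sphere_subset_closedBall (hmem θ))) (abs_nonneg _)
  · exact (hK.abs.mul continuous_const).intervalIntegrable _ _
  · exact Filter.Eventually.of_forall fun θ _ => (hlim _ (hmemU θ)).const_mul _
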